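/- Let G be a connected graph with m ≥ 3 vertices, let Ψ_G = Σ_{T spanning tree} Π_{e ∉ T} x_e be its Kirchhoff (graph) polynomial, and let X_G ⊂ A^{|E|} be its affine zero locus over F_p. Then the number of F_p-points of X_G is divisible by p^2. -/

import Mathlib

open MvPolynomial

open scoped Classical in
/-- The Kirchhoff (graph) polynomial `Ψ_G = Σ_{T spanning tree} Π_{e ∉ T} x_e`, a polynomial
with coefficients in `R` in variables indexed by the edges of `G`.  A spanning tree is a
subset `T` of the edges such that the graph on the vertices of `G` formed by the edges of `T`
is a tree (connectedness forces it to be spanning). -/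
noncomputable def graphPoly {V : Type*} [Fintype V] (G : SimpleGraph V)
    (R : Type*) [CommRing R] : MvPolynomial G.edgeSet R :=
  ∑ T ∈ Finset.univ.filter
      (fun T : Finset G.edgeSet =>
        (SimpleGraph.fromEdgeSet ((T.image Subtype.val : Finset (Sym2 V)) : Set (Sym2 V))).IsTree),
    ∏ e ∈ Tᶜ, X e

/-- Bordered matrix. -/
def bordM {R J : Type*} (p : R) (u v : J → R) (Y : Matrix J J R) : Matrix (Unit ⊕ J) (Unit ⊕ J) R :=
  Matrix.fromBlocks (Matrix.of fun _ _ => p) (Matrix.of fun _ j => u j) (Matrix.of fun i _ => v i) Y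

theorem bordM_transpose {R J : Type*} (p : R) (u v : J → R) (Y : Matrix J J R) :
    (bordM p u v Y).transpose = bordM p v u Y.transpose := by
  ext i j
  rcases i with i | i <;> rcases j with j | j <;> rfl

theorem bordM_map {R S J : Type*} (f : R → S) (p : R) (u v : J → R) (Y : Matrix J J R) :
    (bordM p u v Y).map f = bordM (f p) (f ∘ u) (f ∘ v) (Y.map f) := by
  ext i j
  rcases i with i | i <;> rcases j with j | j <;> rfl

theorem bordM_symm {R J : Type*} [CommRing R] [Fintype J] [DecidableEq J] (p : R) (u v : J → R)
    (Y : Matrix J J R) (hY : Y.IsSymm) : (bordM p u v Y).det = (bordM p v u Y).det := by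
  rw [← Matrix.det_transpose, bordM_transpose, hY.eq]

theorem bordM_add {R J : Type*} [CommRing R] [Fintype J] [DecidableEq J] (p : R) (u v : J → R)
    (Y : Matrix J J R) : (bordM p u v Y).det = p * Y.det + (bordM 0 u v Y).det := by
  have h1 : bordM p u v Y = (bordM p u v Y).updateRow (Sum.inl ())
      (Sum.elim (fun _ => p) (fun _ => 0) + Sum.elim (fun _ => 0) u) := by
    ext i j
    rcases i with i | i <;> rcases j with j | j <;> simp [bordM, Matrix.updateRow_apply]
  have h2 : (bordM p u v Y).updateRow (Sum.inl ()) (Sum.elim (fun _ => 0) u) = bordM 0 u v Y := by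
    ext i j
    rcases i with i | i <;> rcases j with j | j <;> simp [bordM, Matrix.updateRow_apply]
  have h3 : (bordM p u v Y).updateRow (Sum.inl ()) (Sum.elim (fun _ => p) (fun _ => 0))
     = Matrix.fromBlocks (Matrix.of fun _ _ => p) 0 (Matrix.of fun i _ => v i) Y := by
    ext i j
    rcases i with i | i <;> rcases j with j | j <;> simp [bordM, Matrix.updateRow_apply]
  rw [h1, Matrix.det_updateRow_add, h2, h3, Matrix.det_fromBlocks_zero₁₂]
  simp

theorem bordM_swap {R J : Type*} [CommRing R] [Fintype J] [DecidableEq J] (p q : R) (u v : J → R)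
    (Y : Matrix J J R) :
    (bordM p (Sum.elim (fun _ => 0) u) (Sum.elim (fun _ => 0) u) (bordM q v v Y)).det
    = (bordM q (Sum.elim (fun _ => 0) v) (Sum.elim (fun _ => 0) v) (bordM p u u Y)).det := by
  let e : Unit ⊕ (Unit ⊕ J) ≃ Unit ⊕ (Unit ⊕ J) :=
    ((Equiv.sumAssoc Unit Unit J).symm.trans ((Equiv.sumComm Unit Unit).sumCongr (Equiv.refl J))).trans
      (Equiv.sumAssoc Unit Unit J)
  rw [← Matrix.det_submatrix_equiv_self e]
  congr 1
  ext i j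
  rcases i with i | i | i <;> rcases j with j | j | j <;> simp [bordM, e]

theorem bordM_inv {K J : Type*} [Field K] [Fintype J] [DecidableEq J] (p : K) (u v : J → K)
    (Y : Matrix J J K) [Invertible Y] : 
    (bordM p u v Y).det = Y.det * (p - ∑ i, ∑ j, u i * (⅟Y) i j * v j) := by
  rw [bordM, Matrix.det_fromBlocks₂₂]
  congr 1
  simp only [Matrix.det_unique, Matrix.sub_apply, Matrix.mul_apply, Matrix.of_apply, Finset.sum_mul]
  rw [Finset.sum_comm]

theorem dodgson_inv {K J : Type*} [Field K] [Fintype J] [DecidableEq J] (t : K) (u v : J → K)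
    (Y : Matrix J J K) (hY : Y.det ≠ 0) :
    Y.det * (bordM 0 (Sum.elim (fun _ => 0) u) (Sum.elim (fun _ => 0) u) (bordM t v v Y)).det
    = (bordM t v v Y).det * (bordM 0 u u Y).det - (bordM 0 u v Y).det * (bordM 0 v u Y).det := by
  have : Invertible Y := Y.invertibleOfIsUnitDet (Ne.isUnit hY)
  let e : Fin 2 ⊕ J ≃ Unit ⊕ (Unit ⊕ J) :=
    ((finSumFinEquiv (m := 1) (n := 1)).symm.sumCongr (Equiv.refl J)).trans
    (((Equiv.ofUnique (Fin 1) Unit).sumCongr (Equiv.ofUnique (Fin 1) Unit)).sumCongr (Equiv.refl J) |>.trans 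
      (Equiv.sumAssoc Unit Unit J))
  have e0 : e (Sum.inl 0) = Sum.inl () := rfl
  have e1 : e (Sum.inl 1) = Sum.inr (Sum.inl ()) := rfl
  have e2 : ∀ j, e (Sum.inr j) = Sum.inr (Sum.inr j) := fun j => rfl
  have h : (bordM 0 (Sum.elim (fun _ => 0) u) (Sum.elim (fun _ => 0) u) (bordM t v v Y)).submatrix e e
      = Matrix.fromBlocks !![0, 0; 0, t] (Matrix.of ![u, v]) (Matrix.of ![u, v]).transpose Y := by
    ext i j
    rcases i with i | i <;> rcases j with j | j
    · fin_cases i <;> fin_cases j <;> simp [e0, e1, bordM]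
    · fin_cases i <;> simp [e0, e1, e2, bordM]
    · fin_cases j <;> simp [e0, e1, e2, bordM]
    · simp [e2, bordM]
  rw [← Matrix.det_submatrix_equiv_self e, h, Matrix.det_fromBlocks₂₂, Matrix.det_fin_two]
  simp only [bordM_inv]
  have key : ∀ i j : Fin 2, (Matrix.of ![u, v] * ⅟Y * (Matrix.of ![u, v]).transpose) i j
     = ∑ a, ∑ b, (![u, v] i) a * (⅟Y) a b * (![u, v] j) b := by
    intro i j
    simp only [Matrix.mul_apply, Matrix.of_apply, Matrix.transpose_apply, Finset.sum_mul]
    rw [Finset.sum_comm]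
  simp only [Matrix.sub_apply, key]
  simp
  ring

theorem elimmap {J A B : Type*} [CommRing A] [CommRing B] (f : A →+* B) (w : J → A) :
    f ∘ (Sum.elim (fun _ : Unit => 0) w) = Sum.elim (fun _ : Unit => 0) (f ∘ w) := by
  ext i
  rcases i with i | i <;> simp

theorem dodgson {F J : Type*} [Field F] [Fintype J] [DecidableEq J] (t : F) (u v : J → F)
    (Y : Matrix J J F) :
    Y.det * (bordM 0 (Sum.elim (fun _ => 0) u) (Sum.elim (fun _ => 0) u) (bordM t v v Y)).det
    = (bordM t v v Y).det * (bordM 0 u u Y).det - (bordM 0 u v Y).det * (bordM 0 v u Y).det := by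
  let Yp : Matrix J J (Polynomial F) := Matrix.charmatrix (-Y)
  let up : J → Polynomial F := fun j => Polynomial.C (u j)
  let vp : J → Polynomial F := fun j => Polynomial.C (v j)
  let φ : Polynomial F →+* FractionRing (Polynomial F) := algebraMap (Polynomial F) (FractionRing (Polynomial F))
  have hφ : Function.Injective φ := IsFractionRing.injective (Polynomial F) (FractionRing (Polynomial F))
  have hdet : Yp.det ≠ 0 := (Matrix.charpoly_monic (-Y)).ne_zero
  have h1 : Yp.det * (bordM 0 (Sum.elim (fun _ => 0) up) (Sum.elim (fun _ => 0) up) (bordM (Polynomial.C t) vp vp Yp)).det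
    = (bordM (Polynomial.C t) vp vp Yp).det * (bordM 0 up up Yp).det - (bordM 0 up vp Yp).det * (bordM 0 vp up Yp).det := by
    apply hφ
    have := dodgson_inv (φ (Polynomial.C t)) (φ ∘ up) (φ ∘ vp) (Yp.map φ) (by
      rw [← RingHom.mapMatrix_apply, ← RingHom.map_det]
      exact fun h => hdet (hφ (by rw [h, map_zero])))
    simp only [map_mul, map_sub, RingHom.map_det, RingHom.mapMatrix_apply, bordM_map, elimmap, map_zero]
    exact this
  let ψ : Polynomial F →+* F := Polynomial.evalRingHom 0
  have hu : ψ ∘ up = u := by ext j; simp [ψ, up]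
  have hv : ψ ∘ vp = v := by ext j; simp [ψ, vp]
  have hY : Yp.map ψ = Y := by
    ext i j
    by_cases h : i = j
    · subst h; simp [ψ, Yp]
    · simp [ψ, Yp, Matrix.charmatrix_apply_ne _ _ _ h]
  have ht : ψ (Polynomial.C t) = t := by simp [ψ]
  have h2 := congrArg ψ h1
  simp only [map_mul, map_sub, RingHom.map_det, RingHom.mapMatrix_apply, bordM_map, elimmap, map_zero, hu, hv, hY, ht] at h2
  exact h2

section Count
variable {K : Type*} [Fintype K] [DecidableEq K]

/-- The block matrix with diagonal variables. -/
def WM {R : Type*} [CommRing R] {E : Type*} [DecidableEq E] (A : E → K → R) (x : E → R) :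
    Matrix (E ⊕ K) (E ⊕ K) R :=
  Matrix.fromBlocks (Matrix.diagonal x) (Matrix.of A) (Matrix.of A).transpose 0

/-- Extension of a vector by zero. -/
def alphaV {R : Type*} [CommRing R] (E : Type*) (a : K → R) : E ⊕ K → R := Sum.elim (fun _ => 0) a

/-- Bordered determinant. -/
def QM {R : Type*} [CommRing R] {E : Type*} [Fintype E] [DecidableEq E] (A : E → K → R) (x : E → R)
    (a b : K → R) : R := (bordM 0 (alphaV E a) (alphaV E b) (WM A x)).det

theorem WM_symm {R : Type*} [CommRing R] {E : Type*} [DecidableEq E] (A : E → K → R) (x : E → R) :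
    (WM A x).IsSymm := by
  ext i j
  rcases i with i | i <;> rcases j with j | j <;> simp [WM, Matrix.diagonal_apply]
  by_cases h : i = j
  · subst h; simp
  · simp [h, Ne.symm h]

/-- Index equivalence. -/
def eqv (n : ℕ) (K : Type*) : Unit ⊕ (Fin n ⊕ K) ≃ Fin (n + 1) ⊕ K where
  toFun := Sum.elim (fun _ => Sum.inl 0) (Sum.elim (fun i => Sum.inl i.succ) Sum.inr)
  invFun := Sum.elim (Fin.cons (Sum.inl ()) (fun i => Sum.inr (Sum.inl i))) (fun k => Sum.inr (Sum.inr k))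
  left_inv := by
    intro i
    rcases i with i | i | i <;> simp
  right_inv := by
    intro i
    rcases i with i | i
    · refine Fin.cases ?_ (fun i => ?_) i <;> simp
    · simp

variable {R : Type*} [CommRing R]

theorem WM_cons {n : ℕ} (A : Fin n → K → R) (x : Fin n → R) (a : K → R) (t : R) :
    (WM (Fin.cons a A : Fin (n + 1) → K → R) (Fin.cons t x)).submatrix (eqv n K) (eqv n K)
      = bordM t (alphaV _ a) (alphaV _ a) (WM A x) := by
  ext i j
  rcases i with i | i | i <;> rcases j with j | j | j <;>
    simp [WM, bordM, eqv, alphaV, Matrix.diagonal_apply, Fin.succ_ne_zero, (Fin.succ_ne_zero _).symm]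

theorem WM_cons_det {n : ℕ} (A : Fin n → K → R) (x : Fin n → R) (a : K → R) (t : R) :
    (WM (Fin.cons a A : Fin (n + 1) → K → R) (Fin.cons t x)).det
      = t * (WM A x).det + QM A x a a := by
  rw [← Matrix.det_submatrix_equiv_self (eqv n K), WM_cons, bordM_add, QM]

theorem QM_cons' {n : ℕ} (A : Fin n → K → R) (x : Fin n → R) (a c : K → R) (t : R) :
    QM (Fin.cons c A : Fin (n + 1) → K → R) (Fin.cons t x) a a
      = (bordM 0 (Sum.elim (fun _ => 0) (alphaV (Fin n) a)) (Sum.elim (fun _ => 0) (alphaV (Fin n) a))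
        (bordM t (alphaV _ c) (alphaV _ c) (WM A x))).det := by
  rw [← WM_cons, QM, ← Matrix.det_submatrix_equiv_self ((Equiv.refl Unit).sumCongr (eqv n K))]
  congr 1
  ext i j
  rcases i with i | i | i | i <;> rcases j with j | j | j | j <;> simp [bordM, alphaV, eqv]

theorem QM_cons {n : ℕ} (A : Fin n → K → R) (x : Fin n → R) (a c : K → R) (t : R) :
    QM (Fin.cons c A : Fin (n + 1) → K → R) (Fin.cons t x) a a
      = t * QM A x a a + QM (Fin.cons c A : Fin (n + 1) → K → R) (Fin.cons 0 x) a a := by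
  rw [QM_cons', bordM_swap, bordM_add, ← bordM_swap, ← QM_cons']
  rfl

theorem QM_dodgson {F : Type*} [Field F] {n : ℕ} (A : Fin n → K → F) (x : Fin n → F) (a c : K → F) :
    (WM A x).det * QM (Fin.cons c A : Fin (n + 1) → K → F) (Fin.cons 0 x) a a
      = QM A x c c * QM A x a a - QM A x a c ^ 2 := by
  rw [QM_cons', dodgson, bordM_symm _ (alphaV _ c) (alphaV _ a) _ (WM_symm A x), sq]
  rfl

theorem term_deg {F : Type*} [Field F] {n : ℕ} (hK : 2 ≤ Fintype.card K) (A : Fin n → K → F)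
    (a c : K → F) (σ : Equiv.Perm (Unit ⊕ (Fin n ⊕ K))) :
    let M := bordM (0 : MvPolynomial (Fin n) F) (alphaV _ (fun k => C (a k))) (alphaV _ (fun k => C (c k)))
      (WM (fun i k => C (A i k)) (fun i => X i))
    (∏ i, M (σ i) i) = 0 ∨ (∏ i, M (σ i) i).totalDegree < n := by
  intro M
  by_cases hσ : ∀ e : Fin n, σ (Sum.inr (Sum.inl e)) = Sum.inr (Sum.inl e)
  · left
    obtain ⟨k1, k2, hne⟩ := Fintype.one_lt_card_iff.mp (show 1 < Fintype.card K by omega)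
    have key : ∀ k : K, (∏ i, M (σ i) i) ≠ 0 → σ (Sum.inr (Sum.inr k)) = Sum.inl () := by
      intro k hk
      rcases h : σ (Sum.inr (Sum.inr k)) with u | e | k'
      · rfl
      · exfalso
        have := σ.injective (h.trans (hσ e).symm)
        simp at this
      · exfalso
        apply hk
        apply Finset.prod_eq_zero (Finset.mem_univ (Sum.inr (Sum.inr k)))
        rw [h]
        simp [M, bordM, WM]
    by_contra hne0
    have := σ.injective ((key k1 hne0).trans (key k2 hne0).symm)
    simp at this
    exact hne this
  · right
    push Not at hσ
    obtain ⟨e0, he0⟩ := hσ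
    refine lt_of_le_of_lt (totalDegree_finsetProd _ _) ?_
    have hb : ∀ i j, (M i j).totalDegree ≤
        if (∃ e : Fin n, j = Sum.inr (Sum.inl e) ∧ i = j) then 1 else 0 := by
      intro i j
      rcases i with i | i | i <;> rcases j with j | j | j <;> 
        simp [M, bordM, WM, alphaV, Matrix.diagonal_apply]
      by_cases h : i = j
      · subst h; simp
      · simp [h]
    refine lt_of_le_of_lt (Finset.sum_le_sum (fun i _ => hb (σ i) i)) ?_
    rw [Fintype.sum_sum_type, Fintype.sum_sum_type]
    simp only [reduceCtorEq, false_and, exists_false, if_false, Finset.sum_const_zero, zero_add, add_zero,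
      Sum.inr.injEq, Sum.inl.injEq]
    calc _ < ∑ _e : Fin n, 1 := by
          apply Finset.sum_lt_sum
          · intro e _
            split_ifs <;> simp
          · refine ⟨e0, Finset.mem_univ _, ?_⟩
            simp [he0]
      _ = n := by simp

/-- The polynomial with values `QM`. -/
noncomputable def qpoly {F : Type*} [Field F] {n : ℕ} (A : Fin n → K → F)
    (a c : K → F) : MvPolynomial (Fin n) F :=
  QM (fun i k => C (A i k)) (fun i => X i) (fun k => C (a k)) (fun k => C (c k))

theorem qpoly_eval {F : Type*} [Field F] {n : ℕ} (A : Fin n → K → F)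
    (a c : K → F) (x : Fin n → F) : eval x (qpoly A a c) = QM A x a c := by
  rw [qpoly, QM, RingHom.map_det, QM]
  congr 1
  ext i j
  rcases i with i | i | i <;> rcases j with j | j | j <;> 
        simp [bordM, WM, alphaV, Matrix.diagonal_apply]
  split_ifs <;> simp

theorem qpoly_deg {F : Type*} [Field F] {n : ℕ} (hK : 2 ≤ Fintype.card K) (A : Fin n → K → F)
    (a c : K → F) : qpoly A a c = 0 ∨ (qpoly A a c).totalDegree < n := by
  have h := term_deg hK A a c
  rw [qpoly, QM, Matrix.det_apply']
  by_cases hn : n = 0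
  · left
    apply Finset.sum_eq_zero
    intro σ _
    rcases h σ with h | h
    · rw [h, mul_zero]
    · omega
  · right
    refine lt_of_le_of_lt (totalDegree_finsetSum _ _) ?_
    rw [Finset.sup_lt_iff (by simpa using Nat.pos_of_ne_zero hn)]
    intro σ _
    refine lt_of_le_of_lt (totalDegree_mul _ _) ?_
    have h0 : (((Equiv.Perm.sign σ : ℤ) : MvPolynomial (Fin n) F)).totalDegree = 0 := by
      have := totalDegree_C (σ := Fin n) ((Equiv.Perm.sign σ : ℤ) : F)
      simpa using this
    rw [h0, zero_add]
    rcases h σ with h | h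
    · rw [h]; simpa using Nat.pos_of_ne_zero hn
    · exact h


variable {p : ℕ} [hp : Fact p.Prime]

/-- Number of zeros. -/
def Ncount {n : ℕ} (A : Fin n → K → ZMod p) : ℕ :=
  (Finset.univ.filter (fun x : Fin n → ZMod p => (WM A x).det = 0)).card

/-- Number of zeros of the pair. -/
def Pcount {n : ℕ} (A : Fin n → K → ZMod p) (a : K → ZMod p) : ℕ :=
  (Finset.univ.filter (fun x : Fin n → ZMod p => (WM A x).det = 0 ∧ QM A x a a = 0)).card

theorem sum_cons {M : Type*} [AddCommMonoid M] {n : ℕ} (f : (Fin (n + 1) → ZMod p) → M) :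
    ∑ x, f x = ∑ y : Fin n → ZMod p, ∑ t : ZMod p, f (Fin.cons t y) := by
  rw [← Fintype.sum_prod_type_right']
  exact (Fintype.sum_equiv (Fin.consEquiv (fun _ : Fin (n + 1) => ZMod p)) _ _ (fun x => rfl)).symm

theorem lin_sum {M : Type*} [AddCommMonoid M] (D q : ZMod p) (hD : D ≠ 0) (f : ZMod p → M) :
    ∑ t : ZMod p, (if t * D + q = 0 then f t else 0) = f (-q / D) := by
  have : ∀ t : ZMod p, (t * D + q = 0) ↔ t = -q / D := by
    intro t
    rw [eq_div_iff hD, add_eq_zero_iff_eq_neg]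
  simp [this]

theorem fiberP (D qaa qcc qac d : ZMod p) (h : D * d = qcc * qaa - qac ^ 2) :
    (∑ t : ZMod p, (if t * D + qcc = 0 ∧ t * qaa + d = 0 then (1 : ZMod p) else 0))
      = (if qac = 0 then 1 else 0) - (if D = 0 ∧ qaa = 0 then 1 else 0) := by
  by_cases hD : D = 0
  · subst hD
    by_cases hq : qaa = 0
    · subst hq
      have : qac = 0 := by
        have : qac ^ 2 = 0 := by linear_combination h
        exact pow_eq_zero_iff (two_ne_zero) |>.mp this
      subst this
      simp
    · have h1 : qcc = 0 ↔ qac = 0 := by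
        have h2 : qcc * qaa = qac ^ 2 := by linear_combination -h
        constructor
        · rintro rfl
          exact pow_eq_zero_iff (two_ne_zero) |>.mp (by rw [← h2, zero_mul])
        · rintro rfl
          simpa [hq] using h2
      have := lin_sum qaa d hq (fun _ => if qcc = 0 then (1 : ZMod p) else 0)
      simp only [mul_zero, zero_add, hq, and_false, if_false, sub_zero, ← h1]
      rw [← this]
      apply Finset.sum_congr rfl
      intro t _
      by_cases h3 : qcc = 0 <;> simp [h3]
  · have := lin_sum D qcc hD (fun t => if t * qaa + d = 0 then (1 : ZMod p) else 0)
    simp only [hD, false_and, if_false, sub_zero]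
    simp only [ite_and]
    rw [this]
    have h1 : (-qcc / D * qaa + d = 0) ↔ qac = 0 := by
      have h2 : D * (-qcc / D * qaa + d) = - qac ^ 2 := by
        field_simp
        linear_combination h
      constructor
      · intro h3
        rw [h3, mul_zero] at h2
        exact pow_eq_zero_iff (two_ne_zero) |>.mp (by linear_combination h2)
      · rintro rfl
        simpa [hD] using h2
    simp only [h1]

theorem fiberN (D q : ZMod p) :
    (∑ t : ZMod p, (if t * D + q = 0 then (1 : ℤ) else 0))
      = 1 - (if D = 0 then 1 else 0) + p * (if D = 0 ∧ q = 0 then 1 else 0) := by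
  by_cases hD : D = 0
  · subst hD
    by_cases hq : q = 0
    · simp [hq, ZMod.card]
    · simp [hq]
  · have := lin_sum D q hD (fun _ => (1 : ℤ))
    rw [this]
    simp [hD]

theorem Ncount_succ {n : ℕ} (A : Fin n → K → ZMod p) (a : K → ZMod p) :
    (Ncount (Fin.cons a A : Fin (n + 1) → K → ZMod p) : ℤ)
      = (p : ℤ) ^ n - Ncount A + p * Pcount A a := by
  simp only [Ncount, Pcount, Finset.card_filter, Nat.cast_sum, Nat.cast_ite, Nat.cast_one, Nat.cast_zero]
  rw [sum_cons]
  simp only [WM_cons_det, fiberN]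
  rw [Finset.sum_add_distrib, Finset.sum_sub_distrib, ← Finset.mul_sum]
  simp [ZMod.card]

theorem Pcount_succ {n : ℕ} (A : Fin n → K → ZMod p) (a c : K → ZMod p) :
    (Pcount (Fin.cons c A : Fin (n + 1) → K → ZMod p) a : ZMod p)
      = ((Finset.univ.filter (fun x : Fin n → ZMod p => QM A x a c = 0)).card : ZMod p)
        - Pcount A a := by
  simp only [Pcount, Finset.card_filter, Nat.cast_sum, Nat.cast_ite, Nat.cast_one, Nat.cast_zero]
  rw [sum_cons, ← Finset.sum_sub_distrib]
  apply Finset.sum_congr rfl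
  intro y _
  rw [← fiberP _ _ _ _ _ (QM_dodgson A y a c)]
  apply Finset.sum_congr rfl
  intro t _
  rw [WM_cons_det, QM_cons]

theorem Qcount {n : ℕ} (hK : 2 ≤ Fintype.card K) (A : Fin n → K → ZMod p) (a c : K → ZMod p) :
    ((Finset.univ.filter (fun x : Fin n → ZMod p => QM A x a c = 0)).card : ZMod p)
      = if n = 0 then 1 else 0 := by
  rcases qpoly_deg hK A a c with h | h
  · have : ∀ x, QM A x a c = 0 := fun x => by rw [← qpoly_eval, h, map_zero]
    simp only [this, Finset.filter_true, Finset.card_univ, Fintype.card_fun, ZMod.card, Fintype.card_fin]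
    split_ifs with hn
    · simp [hn]
    · simp [hn]
  · have h2 := char_dvd_card_solutions p (σ := Fin n) (K := ZMod p) (f := qpoly A a c) (by simpa using h)
    rw [if_neg (by omega), ← Fintype.card_subtype]
    rw [ZMod.natCast_eq_zero_iff]
    convert h2 using 4
    rw [qpoly_eval]

theorem det_WM_zero (hK : 2 ≤ Fintype.card K) (A : Fin 0 → K → ZMod p) (x) : (WM A x).det = 0 := by
  have : Nonempty K := Fintype.card_pos_iff.mp (by omega)
  have h : WM A x = 0 := by
    ext i j
    rcases i with i | i
    · exact i.elim0
    rcases j with j | j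
    · exact j.elim0
    simp [WM]
  rw [h, Matrix.det_zero]

theorem QM_zero (hK : 2 ≤ Fintype.card K) (A : Fin 0 → K → ZMod p) (x) (a c : K → ZMod p) :
    QM A x a c = 0 := by
  rcases qpoly_deg hK A a c with h | h
  · rw [← qpoly_eval, h, map_zero]
  · omega

theorem Pcount_zero (hK : 2 ≤ Fintype.card K) (A : Fin 0 → K → ZMod p) (a : K → ZMod p) :
    Pcount A a = 1 := by
  simp [Pcount, det_WM_zero hK, QM_zero hK]

theorem Ncount_zero (hK : 2 ≤ Fintype.card K) (A : Fin 0 → K → ZMod p) :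
    Ncount A = 1 := by
  simp [Ncount, det_WM_zero hK]

theorem Pcount_val (hK : 2 ≤ Fintype.card K) {n : ℕ} (A : Fin n → K → ZMod p) (a : K → ZMod p) :
    (Pcount A a : ZMod p) = if n = 0 then 1 else 0 := by
  induction n with
  | zero => simp [Pcount_zero hK]
  | succ n ih =>
    rw [← Fin.cons_self_tail A, Pcount_succ, Qcount hK, ih]
    simp

theorem Ncount_dvd (hK : 2 ≤ Fintype.card K) {n : ℕ} (hn : 2 ≤ n) (A : Fin n → K → ZMod p) :
    p ^ 2 ∣ Ncount A := by
  have hP : ∀ {n : ℕ} (_ : 1 ≤ n) (A : Fin n → K → ZMod p) (a : K → ZMod p),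
      (p : ℤ) ^ 2 ∣ p * (Pcount A a : ℤ) := by
    intro n hn A a
    have := Pcount_val hK A a
    rw [if_neg (by omega), ZMod.natCast_eq_zero_iff] at this
    rw [sq]
    exact mul_dvd_mul_left _ (by exact_mod_cast this)
  induction n, hn using Nat.le_induction with
  | base =>
    have h1 : (Ncount (Fin.tail A) : ℤ) = p := by
      rw [← Fin.cons_self_tail (Fin.tail A), Ncount_succ, Ncount_zero hK, Pcount_zero hK]
      simp
    have h2 := Ncount_succ (Fin.tail A) (A 0)
    rw [Fin.cons_self_tail, h1] at h2
    have := hP le_rfl (Fin.tail A) (A 0)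
    zify
    rw [h2]
    simpa using this
  | succ n hn ih =>
    have h2 := Ncount_succ (Fin.tail A) (A 0)
    rw [Fin.cons_self_tail] at h2
    zify
    rw [h2]
    refine dvd_add (dvd_sub (pow_dvd_pow _ hn) (by exact_mod_cast ih _)) (hP (by omega) _ _)

theorem card_dvd {E : Type*} [Fintype E] [DecidableEq E] (hK : 2 ≤ Fintype.card K)
    (hE : 2 ≤ Fintype.card E) (A : E → K → ZMod p) :
    p ^ 2 ∣ Nat.card {x : E → ZMod p // (WM A x).det = 0} := by
  let e := Fintype.equivFin E
  have h := Ncount_dvd hK hE (fun i => A (e.symm i))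
  convert h using 1
  rw [Ncount, ← Fintype.card_subtype, Nat.card_eq_fintype_card]
  apply Fintype.card_congr
  refine (e.arrowCongr (Equiv.refl (ZMod p))).subtypeEquiv ?_
  intro x
  rw [← Matrix.det_submatrix_equiv_self (e.symm.sumCongr (Equiv.refl K)) (WM A x)]
  have : (WM A x).submatrix (e.symm.sumCongr (Equiv.refl K)) (e.symm.sumCongr (Equiv.refl K))
     = WM (fun i => A (e.symm i)) ((e.arrowCongr (Equiv.refl (ZMod p))) x) := by
    ext i j
    rcases i with i | i <;> rcases j with j | j <;> simp [WM, Matrix.diagonal_apply]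
  rw [this]

end Count

section Expand
variable {E K F : Type*} [Fintype E] [DecidableEq E] [Fintype K] [DecidableEq K] [Field F]

/-- Matrix of the term of the expansion attached to `T`. -/
def ZM (A : E → K → F) (T : Finset E) : Matrix (E ⊕ K) (E ⊕ K) F :=
  Matrix.of (Sum.elim
    (fun e => if e ∈ T then Sum.elim (fun _ => 0) (A e) else Pi.single (Sum.inl e) 1)
    (fun k => Sum.elim (fun e => A e k) (fun _ => 0)))

theorem WM_expand (A : E → K → F) (x : E → F) :
    (WM A x).det = ∑ T : Finset E, (∏ e ∈ Tᶜ, x e) * (ZM A T).det := by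
  let f := (Matrix.detRowAlternating (R := F) (n := E ⊕ K)).toMultilinearMap.currySum
  let Kr : K → (E ⊕ K → F) := fun k => Sum.elim (fun e => A e k) (fun _ => 0)
  have hf : ∀ m, f m Kr = Matrix.det (Matrix.of (Sum.elim m Kr)) := by
    intro m
    rfl
  have h1 : WM A x = Matrix.of (Sum.elim ((fun e => Sum.elim (fun _ => 0) (A e)) +
      (fun e => x e • Pi.single (Sum.inl e) 1)) Kr) := by
    ext i j
    rcases i with i | i <;> rcases j with j | j <;>
      simp [WM, Kr, Matrix.diagonal_apply, Pi.single_apply, eq_comm]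
  rw [h1, ← hf, MultilinearMap.map_add_univ, sum_apply]
  apply Finset.sum_congr rfl
  intro T _
  have h2 : T.piecewise (fun e => Sum.elim (fun _ => 0) (A e))
      (fun e => x e • (Pi.single (Sum.inl e) 1 : E ⊕ K → F))
    = fun e => (if e ∈ T then 1 else x e) •
      (if e ∈ T then Sum.elim (fun _ => 0) (A e) else (Pi.single (Sum.inl e) 1 : E ⊕ K → F)) := by
    ext e : 1
    by_cases he : e ∈ T <;> simp [he]
  rw [h2, MultilinearMap.map_smul_univ, smul_apply, hf, smul_eq_mul]
  congr 1
  rw [Finset.prod_ite]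
  simp only [Finset.prod_const_one, one_mul]
  apply Finset.prod_congr
  · ext e; simp
  · simp

theorem ZM_det_zero1 (A : E → K → F) (T : Finset E) (w : K → F) (hw : w ≠ 0)
    (h : ∀ e ∈ T, ∑ k, A e k * w k = 0) : (ZM A T).det = 0 := by
  rw [← Matrix.exists_mulVec_eq_zero_iff]
  refine ⟨Sum.elim (fun _ => 0) w, ?_, ?_⟩
  · intro h0
    apply hw
    ext k
    exact congrFun h0 (Sum.inr k)
  · ext i
    rcases i with e | k
    · by_cases he : e ∈ T
      · simpa [Matrix.mulVec, dotProduct, ZM, he] using h e he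
      · simp [Matrix.mulVec, dotProduct, ZM, he, Pi.single_apply]
    · simp [Matrix.mulVec, dotProduct, ZM]

theorem ZM_det_zero2 (A : E → K → F) (T : Finset E) (h : Fintype.card K < T.card) :
    (ZM A T).det = 0 := by
  let L : (T → F) →ₗ[F] (K → F) := Matrix.vecMulLinear (Matrix.of fun (e : T) k => A e.1 k)
  have hker : LinearMap.ker L ≠ ⊥ := by
    apply LinearMap.ker_ne_bot_of_finrank_lt
    simpa using h
  obtain ⟨y, hy, hy0⟩ := (Submodule.ne_bot_iff _).mp hker
  have hy' : ∀ k, ∑ e : T, y e * A e.1 k = 0 := by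
    intro k
    have := congrFun (LinearMap.mem_ker.mp hy) k
    simpa [L, Matrix.vecMul, dotProduct] using this
  rw [← Matrix.exists_mulVec_eq_zero_iff]
  refine ⟨Sum.elim (fun e => if h : e ∈ T then y ⟨e, h⟩ else 0) (fun _ => 0), ?_, ?_⟩
  · intro h0
    apply hy0
    ext e
    simpa using congrFun h0 (Sum.inl e.1)
  · ext i
    rcases i with e | k
    · by_cases he : e ∈ T
      · simp [Matrix.mulVec, dotProduct, ZM, he]
      · simp [Matrix.mulVec, dotProduct, ZM, he, Pi.single_apply]
    · have h3 := hy' k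
      simp only [Matrix.mulVec, dotProduct, ZM, Matrix.of_apply, Fintype.sum_sum_type, Sum.elim_inl,
        Sum.elim_inr, mul_zero, Finset.sum_const_zero, add_zero, Pi.zero_apply]
      refine Eq.trans ?_ h3
      rw [← Finset.sum_subset (Finset.subset_univ T), ← Finset.sum_coe_sort T]
      · apply Finset.sum_congr rfl
        intro e _
        simp [mul_comm]
      · intro e _ he
        simp [he]

theorem ZM_det_tree (A : E → K → F) (T : Finset E) (φ : K ≃ T)
    (h : (Matrix.of fun k k' => A (φ k).1 k').det ^ 2 = 1) :
    (ZM A T).det = (Matrix.fromBlocks 0 1 1 0 : Matrix (K ⊕ K) (K ⊕ K) F).det := by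
  let q : E ⊕ K → Prop := fun i => ∃ e, i = Sum.inl e ∧ e ∉ T
  let := Classical.decPred q
  rw [Matrix.twoBlockTriangular_det' (ZM A T) q]
  · have h1 : Matrix.toSquareBlockProp (ZM A T) q = 1 := by
      ext ⟨i, e, rfl, he⟩ ⟨j, e', rfl, he'⟩
      simp [Matrix.toSquareBlockProp, ZM, he, Matrix.one_apply, Pi.single_apply, eq_comm]
    let g : K ⊕ K → {i // ¬ q i} := Sum.elim (fun k => ⟨Sum.inl (φ k).1, by
      rintro ⟨e, h1, h2⟩
      have h1 := Sum.inl.inj h1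
      exact h2 (h1 ▸ (φ k).2)⟩) (fun k => ⟨Sum.inr k, by rintro ⟨e, h1, h2⟩; cases h1⟩)
    have hg : Function.Bijective g := by
      constructor
      · rintro (k | k) (k' | k') hk
        · have := Sum.inl.inj (congrArg Subtype.val hk)
          rw [φ.injective (Subtype.ext this)]
        · cases (congrArg Subtype.val hk)
        · cases (congrArg Subtype.val hk)
        · have := Sum.inr.inj (congrArg Subtype.val hk)
          rw [this]
      · rintro ⟨e | k, h1⟩
        · have he : e ∈ T := by
            by_contra he
            exact h1 ⟨e, rfl, he⟩
          refine ⟨Sum.inl (φ.symm ⟨e, he⟩), ?_⟩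
          simp [g]
        · exact ⟨Sum.inr k, rfl⟩
    let g' := Equiv.ofBijective g hg
    let B : Matrix K K F := Matrix.of fun k k' => A (φ k).1 k'
    have h2 : (Matrix.toSquareBlockProp (ZM A T) (fun i => ¬ q i)).submatrix g' g'
        = Matrix.fromBlocks B 0 0 B.transpose * Matrix.fromBlocks 0 1 1 0 := by
      rw [Matrix.fromBlocks_multiply]
      ext i j
      rcases i with i | i <;> rcases j with j | j <;>
        simp [Matrix.toSquareBlockProp, ZM, g', g, B]
    rw [h1, Matrix.det_one, one_mul, ← Matrix.det_submatrix_equiv_self g', h2, Matrix.det_mul,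
      Matrix.det_fromBlocks_zero₂₁, Matrix.det_transpose, ← sq, h, one_mul]
  · rintro i ⟨e, rfl, he⟩ j hj
    have : j ≠ Sum.inl e := by
      rintro rfl
      exact hj ⟨e, rfl, he⟩
    simp [ZM, he, this]

theorem swap_det_ne : (Matrix.fromBlocks 0 1 1 0 : Matrix (K ⊕ K) (K ⊕ K) F).det ≠ 0 := by
  have h : (Matrix.fromBlocks 0 1 1 0 : Matrix (K ⊕ K) (K ⊕ K) F) * Matrix.fromBlocks 0 1 1 0 = 1 := by
    rw [Matrix.fromBlocks_multiply]
    simp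
  intro h0
  have := congrArg Matrix.det h
  rw [Matrix.det_mul, h0, Matrix.det_one] at this
  simp at this

end Expand

section Graph
open scoped Classical
variable {V : Type*} [Fintype V]

/-- Signed incidence. -/
noncomputable def inc (e : Sym2 V) (w : V) : ℤ :=
  (if w = (Quot.out e).1 then 1 else 0) - (if w = (Quot.out e).2 then 1 else 0)

theorem inc_sum {M : Type*} [CommRing M] (e : Sym2 V) (f : V → M) :
    ∑ w, (inc e w : M) * f w = f (Quot.out e).1 - f (Quot.out e).2 := by
  simp [inc, sub_mul, Finset.sum_sub_distrib]

theorem out_cases (a b : V) : ((Quot.out s(a, b)).1 = a ∧ (Quot.out s(a, b)).2 = b) ∨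
    ((Quot.out s(a, b)).1 = b ∧ (Quot.out s(a, b)).2 = a) := by
  have h : s((Quot.out s(a, b)).1, (Quot.out s(a, b)).2) = s(a, b) := Quot.out_eq s(a, b)
  rwa [Sym2.eq_iff] at h

theorem sum_ne_root {M : Type*} [AddCommMonoid M] (r : V) (f : V → M) (h : f r = 0) :
    ∑ k : {v // v ≠ r}, f k.1 = ∑ v, f v := by
  rw [← Finset.sum_subtype (Finset.univ.filter (fun v => v ≠ r)) (by simp) f, Finset.sum_filter]
  apply Finset.sum_congr rfl
  intro v _
  by_cases hv : v = r
  · simp [hv, h]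
  · simp [hv]

variable (G : SimpleGraph V)

/-- The graph attached to a set of edges. -/
def TG (T : Finset G.edgeSet) : SimpleGraph V :=
  SimpleGraph.fromEdgeSet ((T.image Subtype.val : Finset (Sym2 V)) : Set (Sym2 V))

theorem TG_edgeSet (T : Finset G.edgeSet) :
    (TG G T).edgeSet = ((T.image Subtype.val : Finset (Sym2 V)) : Set (Sym2 V)) := by
  rw [TG, SimpleGraph.edgeSet_fromEdgeSet, sdiff_eq_left, Set.disjoint_left]
  intro e he
  obtain ⟨e', _, rfl⟩ := Finset.mem_image.mp (Finset.mem_coe.mp he)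
  exact G.not_isDiag_of_mem_edgeSet e'.2

theorem TG_card (T : Finset G.edgeSet) : Nat.card (TG G T).edgeSet = T.card := by
  rw [TG_edgeSet, Nat.card_coe_set_eq, Set.ncard_coe_finset,
    Finset.card_image_of_injective _ Subtype.val_injective]

theorem TG_adj (T : Finset G.edgeSet) (e : G.edgeSet) (he : e ∈ T) :
    (TG G T).Adj (Quot.out e.1).1 (Quot.out e.1).2 := by
  rw [← SimpleGraph.mem_edgeSet, TG_edgeSet]
  have h : s((Quot.out e.1).1, (Quot.out e.1).2) = e.1 := Quot.out_eq e.1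
  rw [h]
  simpa using he

theorem path_vec (T : Finset G.edgeSet) (u v : V) (h : (TG G T).Reachable u v) :
    ∃ y : T → ℤ, ∀ w, ∑ e : T, y e * inc e.1.1 w = (if w = v then 1 else 0) - (if w = u then 1 else 0) := by
  obtain ⟨W⟩ := h
  induction W with
  | nil => exact ⟨0, by simp⟩
  | @cons a b c hab W ih =>
    obtain ⟨y, hy⟩ := ih
    have hm : s(a, b) ∈ (TG G T).edgeSet := hab
    rw [TG_edgeSet] at hm
    obtain ⟨e, he, hee⟩ := Finset.mem_image.mp (Finset.mem_coe.mp hm)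
    have key : ∃ z : ℤ, ∀ w, z * inc e.1 w = (if w = b then 1 else 0) - (if w = a then 1 else 0) := by
      rw [hee]
      rcases out_cases a b with ⟨h1, h2⟩ | ⟨h1, h2⟩
      · exact ⟨-1, fun w => by rw [inc, h1, h2]; ring⟩
      · exact ⟨1, fun w => by rw [inc, h1, h2]; ring⟩
    obtain ⟨z, hz⟩ := key
    refine ⟨y + Pi.single ⟨e, he⟩ z, fun w => ?_⟩
    simp only [Pi.add_apply, add_mul, Finset.sum_add_distrib, hy]
    rw [Finset.sum_eq_single (⟨e, he⟩ : T)]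
    · rw [Pi.single_eq_same, hz]; ring
    · intro e' _ hne
      rw [Pi.single_eq_of_ne hne, zero_mul]
    · simp

variable (F : Type*) [Field F] (r : V)

/-- Reduced incidence matrix. -/
noncomputable def incA (e : G.edgeSet) (k : {v // v ≠ r}) : F := (inc e.1 k.1 : F)

theorem det_disconn (T : Finset G.edgeSet) (h : ¬ (TG G T).Connected) :
    (ZM (incA G F r) T).det = 0 := by
  let w' : V → F := fun v => if (TG G T).Reachable r v then 0 else 1
  have hr : w' r = 0 := by simp [w']
  apply ZM_det_zero1 _ _ (fun k => w' k.1)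
  · intro h0
    apply h
    have hall : ∀ v, (TG G T).Reachable r v := by
      intro v
      by_cases hv : v = r
      · rw [hv]
      · by_contra hn
        have := congrFun h0 ⟨v, hv⟩
        simp [w', hn] at this
    have : Nonempty V := ⟨r⟩
    exact ⟨fun a b => (hall a).symm.trans (hall b)⟩
  · intro e he
    have hs := sum_ne_root r (fun v => (inc e.1 v : F) * w' v) (by simp [hr])
    simp only [incA]
    rw [hs, inc_sum]
    have hadj := (TG_adj G T e he).reachable
    have : (TG G T).Reachable r (Quot.out e.1).1 ↔ (TG G T).Reachable r (Quot.out e.1).2 :=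
      ⟨fun h => h.trans hadj, fun h => h.trans hadj.symm⟩
    simp [w', this]

theorem card_K : Fintype.card {v // v ≠ r} + 1 = Fintype.card V := by
  have := Fintype.card_subtype_compl (fun v => v = r)
  have h2 : 0 < Fintype.card V := Fintype.card_pos_iff.mpr ⟨r⟩
  simp at this
  simp
  omega

theorem det_tree (T : Finset G.edgeSet) (h : (TG G T).IsTree) :
    (ZM (incA G F r) T).det =
      (Matrix.fromBlocks 0 1 1 0 : Matrix ({v // v ≠ r} ⊕ {v // v ≠ r}) _ F).det := by
  have hc := (SimpleGraph.isTree_iff_connected_and_card.mp h)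
  have hcard : Fintype.card {v // v ≠ r} = Fintype.card T := by
    have h1 := card_K r
    have h2 := hc.2
    rw [TG_card, Nat.card_eq_fintype_card] at h2
    rw [Fintype.card_coe]
    omega
  let φ : {v // v ≠ r} ≃ T := Fintype.equivOfCardEq hcard
  apply ZM_det_tree _ _ φ
  let B : Matrix {v // v ≠ r} {v // v ≠ r} ℤ := Matrix.of fun k k' => inc (φ k).1.1 k'.1
  have hB : (Matrix.of fun k k' => incA G F r (φ k).1 k') = (Int.castRingHom F).mapMatrix B := by
    ext i j
    simp [B, incA]
  choose y hy using fun v => path_vec G T r v (hc.1.preconnected r v)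
  let C' : Matrix {v // v ≠ r} {v // v ≠ r} ℤ := Matrix.of fun v k => y v.1 (φ k)
  have hCB : C' * B = 1 := by
    ext v w
    rw [Matrix.mul_apply]
    simp only [C', B, Matrix.of_apply]
    rw [φ.sum_comp (fun e : T => y v.1 e * inc e.1.1 w.1), hy]
    simp [w.2, Matrix.one_apply, Subtype.ext_iff, eq_comm]
  have hu : IsUnit B.det := by
    have := congrArg Matrix.det hCB
    rw [Matrix.det_mul, Matrix.det_one] at this
    exact IsUnit.of_mul_eq_one _ ((mul_comm _ _).trans this)
  rw [hB, ← RingHom.map_det, ← map_pow, Int.isUnit_sq hu, map_one]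

theorem det_not_tree (T : Finset G.edgeSet) (h : ¬ (TG G T).IsTree) :
    (ZM (incA G F r) T).det = 0 := by
  by_cases hc : (TG G T).Connected
  · apply ZM_det_zero2
    have h1 := hc.card_vert_le_card_edgeSet_add_one
    have h2 : ¬ (Nat.card (TG G T).edgeSet + 1 = Nat.card V) := fun h2 =>
      h (SimpleGraph.isTree_iff_connected_and_card.mpr ⟨hc, h2⟩)
    have h3 := card_K r
    rw [TG_card, Nat.card_eq_fintype_card] at h1 h2
    omega
  · exact det_disconn G F r T hc

theorem det_eq_graphPoly (x : G.edgeSet → F) :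
    (WM (incA G F r) x).det = eval x (graphPoly G F) *
      (Matrix.fromBlocks 0 1 1 0 : Matrix ({v // v ≠ r} ⊕ {v // v ≠ r}) _ F).det := by
  rw [WM_expand, graphPoly, map_sum, Finset.sum_mul, Finset.sum_filter]
  apply Finset.sum_congr (by congr!)
  intro T _
  split_ifs with h
  · rw [det_tree G F r T h]
    simp only [map_prod, eval_X]
  · rw [det_not_tree G F r T h, mul_zero]

end Graph

theorem stmt12 {V : Type*} [Fintype V] (G : SimpleGraph V) (hconn : G.Connected)
    (hV : 3 ≤ Fintype.card V) (p : ℕ) [Fact p.Prime] :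
    p ^ 2 ∣ Nat.card {x : G.edgeSet → ZMod p // eval x (graphPoly G (ZMod p)) = 0} := by
  classical
  obtain ⟨r⟩ := hconn.nonempty
  have h1 := card_K r
  have hE : 2 ≤ Fintype.card G.edgeSet := by
    have := hconn.card_vert_le_card_edgeSet_add_one
    rw [Nat.card_eq_fintype_card, Nat.card_eq_fintype_card] at this
    omega
  have h := card_dvd (p := p) (by omega) hE (incA G (ZMod p) r)
  have h2 : ∀ x, (WM (incA G (ZMod p) r) x).det = 0 ↔ eval x (graphPoly G (ZMod p)) = 0 := by
    intro x
    rw [det_eq_graphPoly, mul_eq_zero, or_iff_left swap_det_ne]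
  simpa only [h2] using h
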